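/- arXiv:1307.3862 — 2 statements merged into one kernel-verified Lean document; each statement's English description precedes it below -/
import Mathlib

section
/- Let 1 ≤ m ≤ n and j ≥ 1 be integers. The operators B_j = P_n^0 M^j P_n^0 − P_n^m M^j P_n^m and C_j = (P_n^m M P_n^m)^j − (P_n^0 M P_n^0)^j on L²(S²) each have operator norm at most 2 and rank at most (2m−1)(n+1) − m(m−1). -/
open MeasureTheory Finset

noncomputable section

namespace SFT

/-- The recurrence coefficients `b_l^{(α)}` of the orthonormal ultraspherical polynomials. -/
def b (α : ℝ) : ℕ → ℝ
  | 0 => Real.sqrt (Real.sqrt Real.pi * Real.Gamma (α + 1) / (2 * Real.Gamma (α + 3 / 2)))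
  | l + 1 => Real.sqrt ((((l : ℝ) + 1) * (((l : ℝ) + 1) + 2 * α)) /
      ((2 * ((l : ℝ) + 1) + 2 * α + 1) * (2 * ((l : ℝ) + 1) + 2 * α - 1)))

/-- The associated ultraspherical polynomials: `pA α m l x = p_l^{(α)}(x, m)`.
For `m = 0` these are the orthonormal ultraspherical polynomials `p_l^{(α)}(x)`. -/
def pA (α : ℝ) (m : ℕ) : ℕ → ℝ → ℝ
  | 0, _ => 1 / b α m
  | 1, x => x * (1 / b α m) / b α (m + 1)
  | l + 2, x => (x * pA α m (l + 1) x - b α (m + l + 1) * pA α m l x) / b α (m + l + 2)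

/-- The orthonormal ultraspherical polynomials `p_l^{(α)}(x)`. -/
def p (α : ℝ) (l : ℕ) (x : ℝ) : ℝ := pA α 0 l x

/-- Ultraspherical polynomials with integer index; in particular `p_{-1}^{(α)} = 0`. -/
def pZ (α : ℝ) (l : ℤ) (x : ℝ) : ℝ := if 0 ≤ l then p α l.toNat x else 0

/-- `JE α M i j` is the `(i,j)` entry (`0`-based) of the truncated Jacobi matrix
`J(α)_L^M` (of any size `L − M + 1`). -/
def JE (α : ℝ) (M : ℕ) (i j : ℕ) : ℝ :=
  if i + 1 = j then b α (M + i + 1) else if j + 1 = i then b α (M + j + 1) else 0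

/-- The truncated Jacobi matrix `J(α)_{M+l}^M`, of size `(l+1) × (l+1)`.
In particular `Jt α 0 l` is the Jacobi matrix `J(α)_l`. -/
def Jt (α : ℝ) (M l : ℕ) : Matrix (Fin (l + 1)) (Fin (l + 1)) ℝ :=
  fun i j => JE α M i.1 j.1

/-- The spherical harmonics `Y_l^k(θ, φ)`. -/
def Y (l : ℕ) (k : ℤ) (θ φ : ℝ) : ℂ :=
  ((Real.sin θ ^ k.natAbs : ℝ) : ℂ) * ((p (k.natAbs : ℝ) (l - k.natAbs) (Real.cos θ) : ℝ) : ℂ) *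
    Complex.exp (Complex.I * (k : ℂ) * (φ : ℂ))

/-- Parameter region `[0, π] × [0, 2π]` of spherical coordinates. -/
def region : Set (ℝ × ℝ) := Set.Icc (0 : ℝ) Real.pi ×ˢ Set.Icc (0 : ℝ) (2 * Real.pi)

/-- The inner product of `L²(S²)`. -/
def inner2 (f g : ℝ → ℝ → ℂ) : ℂ :=
  (1 / (4 * Real.pi)) *
    ∫ q in region, f q.1 q.2 * (starRingEnd ℂ) (g q.1 q.2) * ((Real.sin q.1 : ℝ) : ℂ)

/-- The norm of `L²(S²)`. -/
def norm2 (f : ℝ → ℝ → ℂ) : ℝ := Real.sqrt (inner2 f f).re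

/-- Membership in `L²(S²)`. -/
def MemL2 (f : ℝ → ℝ → ℂ) : Prop :=
  Measurable (fun q : ℝ × ℝ => f q.1 q.2) ∧
    IntegrableOn (fun q : ℝ × ℝ => ‖f q.1 q.2‖ ^ 2 * Real.sin q.1) region

/-- The multiplication operator `M`. -/
def Mop (f : ℝ → ℝ → ℂ) : ℝ → ℝ → ℂ := fun θ φ => ((Real.cos θ : ℝ) : ℂ) * f θ φ

/-- The power `M^j` of the multiplication operator. -/
def Mpow (j : ℕ) (f : ℝ → ℝ → ℂ) : ℝ → ℝ → ℂ := fun θ φ => ((Real.cos θ : ℝ) : ℂ) ^ j * f θ φ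

/-- The mean value `ε(f)`. -/
def eps (f : ℝ → ℝ → ℂ) : ℝ :=
  (1 / (4 * Real.pi)) * ∫ q in region, Real.cos q.1 * ‖f q.1 q.2‖ ^ 2 * Real.sin q.1

/-- The projection `P_n^m` onto `Π_n^m`. -/
def Pr (n m : ℕ) (f : ℝ → ℝ → ℂ) : ℝ → ℝ → ℂ :=
  fun θ φ => ∑ l ∈ Finset.Icc m n, ∑ k ∈ Finset.Icc (-(l : ℤ)) (l : ℤ),
    inner2 f (Y l k) * Y l k θ φ

/-- The space–frequency operator `P_n^m M P_n^m`. -/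
def SFop (n m : ℕ) (f : ℝ → ℝ → ℂ) : ℝ → ℝ → ℂ := Pr n m (Mop (Pr n m f))

/-- The space `Π_n^m`, spanned by the spherical harmonics `Y_l^k`, `m ≤ l ≤ n`, `|k| ≤ l`. -/
def Pi_nm (n m : ℕ) : Submodule ℂ (ℝ → ℝ → ℂ) :=
  Submodule.span ℂ {g | ∃ l : ℕ, ∃ k : ℤ, m ≤ l ∧ l ≤ n ∧ k.natAbs ≤ l ∧ g = Y l k}

/-- `N_k = n − max(|k|, m) + 1`. -/
def Nk (n m k : ℕ) : ℕ := n - max k m + 1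

/-- The normalizing constant `κ_{k,i}`, given the corresponding root value `xr`. -/
def kap (n m k : ℕ) (xr : ℝ) : ℝ :=
  (Real.sqrt (∑ l ∈ Finset.Icc (max k m) n, (pA (k : ℝ) (m - k) (l - max k m) xr) ^ 2))⁻¹

/-- The eigenfunction `ψ_{k,i}`, given the corresponding root value `xr`. -/
def psiFun (n m : ℕ) (k : ℤ) (xr : ℝ) : ℝ → ℝ → ℂ :=
  fun θ φ => ((kap n m k.natAbs xr : ℝ) : ℂ) *
    ∑ l ∈ Finset.Icc (max k.natAbs m) n,
      ((pA (k.natAbs : ℝ) (m - k.natAbs) (l - max k.natAbs m) xr : ℝ) : ℂ) * Y l k θ φ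

section OrthoPoly

open Polynomial

/-- recurrence coefficient with `bet 0 = 0` -/
def bet (a : ℕ) : ℕ → ℝ
  | 0 => 0
  | l + 1 => b a (l + 1)

/-- polynomial version of `p`, shifted by one: `PP a 0 = 0` and `PP a (l+1)` is `p_l` -/
def PP (a : ℕ) : ℕ → ℝ[X]
  | 0 => 0
  | 1 => C (1 / b a 0)
  | l + 2 => C (1 / bet a (l + 1)) * (X * PP a (l + 1) - C (bet a l) * PP a l)

lemma eval_PP (a : ℕ) (l : ℕ) (x : ℝ) : (PP a (l+1)).eval x = p a l x := by
  unfold p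
  induction l using Nat.twoStepInduction with
  | zero => simp [PP, pA]
  | one => simp [PP, pA, bet]; ring
  | more l h1 h2 =>
    rw [PP]
    simp only [pA, eval_mul, eval_C, eval_sub, eval_X, h1, h2, zero_add, bet]
    ring

lemma b_pos (a : ℕ) (l : ℕ) : 0 < b a l := by
  cases l with
  | zero =>
    have h1 : 0 < Real.Gamma ((a:ℝ) + 1) := Real.Gamma_pos_of_pos (by positivity)
    have h2 : 0 < Real.Gamma ((a:ℝ) + 3/2) := Real.Gamma_pos_of_pos (by positivity)
    have h3 := Real.pi_pos
    unfold b
    positivity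
  | succ l =>
    unfold b
    apply Real.sqrt_pos.mpr
    have : (0:ℝ) < 2 * ((l:ℝ) + 1) + 2 * a - 1 := by
      have : (0:ℝ) ≤ l := by positivity
      have : (0:ℝ) ≤ a := by positivity
      linarith
    positivity

lemma bet_sq (a : ℕ) (l : ℕ) : bet a l ^ 2 * ((2 * l + 2 * a + 1) * (2 * l + 2 * a - 1)) =
    l * (l + 2 * a) := by
  cases l with
  | zero => simp [bet]
  | succ l =>
    unfold bet b
    have h0 : (0:ℝ) < 2 * ((l:ℝ) + 1) + 2 * a - 1 := by
      have : (0:ℝ) ≤ l := by positivity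
      have : (0:ℝ) ≤ a := by positivity
      linarith
    rw [Real.sq_sqrt (by positivity)]
    rw [div_mul_eq_mul_div, div_eq_iff (by positivity)]
    push_cast
    ring

lemma bet_pos (a l : ℕ) : 0 < bet a (l+1) := b_pos a (l+1)

lemma bet_step (a l : ℕ) : 1 + (2 * l + 2 * a + 1 - 2) * bet a l ^ 2 =
    (2 * l + 2 * a + 3) * bet a (l+1) ^ 2 := by
  have h1 := bet_sq a l
  have h2 := bet_sq a (l+1)
  have h : (0:ℝ) < 2 * l + 2 * a + 1 := by positivity
  apply mul_right_cancel₀ h.ne'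
  push_cast at h2
  linear_combination h1 - h2

lemma rec2 (a l : ℕ) : C (bet a (l+1)) * PP a (l+2) = X * PP a (l+1) - C (bet a l) * PP a l := by
  have := (bet_pos a l).ne'
  rw [PP, ← mul_assoc, ← C_mul, mul_one_div_cancel this, C_1, one_mul]

lemma deriv_PP (a l : ℕ) : (1 - X^2) * derivative (PP a (l+1)) =
    - C (l:ℝ) * X * PP a (l+1) + C ((2 * l + 2 * a + 1) * bet a l) * PP a l := by
  induction l using Nat.twoStepInduction with
  | zero => simp [PP]
  | one =>
    have hc : C (bet a 1) ≠ 0 := by simpa using (bet_pos a 0).ne'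
    apply mul_left_cancel₀ hc
    have h1 := rec2 a 0
    have hs := congrArg C (bet_step a 0)
    have hd0 : derivative (PP a 1) = 0 := by simp [PP]
    have hd1 := congrArg derivative h1
    simp only [bet, PP, derivative_mul, derivative_sub, derivative_C, derivative_X] at h1 hd1 hs ⊢
    simp only [C_mul, C_add, C_sub, C_pow, C_ofNat, C_1, C_0, Nat.cast_zero, Nat.cast_one, zero_add, bet] at *
    linear_combination (1 - X^2) * hd1 + X * h1 + C (1 / b a 0) * hs
  | more l h1 h2 =>
    have hc : C (bet a (l+2)) ≠ 0 := by simpa using (bet_pos a (l+1)).ne'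
    apply mul_left_cancel₀ hc
    have r1 := rec2 a (l+1)
    have r0 := rec2 a l
    have hd1 := congrArg derivative r1
    have hs := congrArg C (bet_step a (l+1))
    simp only [derivative_mul, derivative_sub, derivative_C, derivative_X] at hd1
    simp only [C_mul, C_add, C_sub, C_pow, C_ofNat, C_1, Nat.cast_add, Nat.cast_one, Nat.cast_ofNat] at *
    simp only [add_assoc, Nat.reduceAdd] at *
    linear_combination (1 - X^2) * hd1 + (C (l:ℝ) + 2) * X * r1 + PP a (l+2) * hs + X * h2 - C (bet a (l+1)) * h1 - C (bet a (l+1)) * (2 * C (l:ℝ) + 2 * C (a:ℝ) + 1) * r0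

/-- integral of a polynomial in `cos θ` against the ultraspherical weight -/
def LL (a : ℕ) (q : ℝ[X]) : ℝ := ∫ θ in (0:ℝ)..Real.pi, q.eval (Real.cos θ) * Real.sin θ ^ (2 * a + 1)

lemma LL_cont (a : ℕ) (q : ℝ[X]) : Continuous (fun θ : ℝ => q.eval (Real.cos θ) * Real.sin θ ^ (2 * a + 1)) := by
  fun_prop

lemma LL_add (a : ℕ) (q r : ℝ[X]) : LL a (q + r) = LL a q + LL a r := by
  unfold LL
  rw [← intervalIntegral.integral_add ((LL_cont a q).intervalIntegrable _ _)
    ((LL_cont a r).intervalIntegrable _ _)]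
  congr 1; ext θ; rw [eval_add]; ring

lemma LL_C (a : ℕ) (c : ℝ) (q : ℝ[X]) : LL a (C c * q) = c * LL a q := by
  unfold LL
  rw [← intervalIntegral.integral_const_mul]
  congr 1; ext θ; rw [eval_mul, eval_C]; ring

lemma LL_sub (a : ℕ) (q r : ℝ[X]) : LL a (q - r) = LL a q - LL a r := by
  have := LL_add a (q - r) r
  rw [sub_add_cancel] at this
  linarith

lemma LL_deriv (a : ℕ) (r : ℝ[X]) :
    LL a ((1 - X^2) * derivative r - C (2 * (a:ℝ) + 2) * (X * r)) = 0 := by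
  have hF : ∀ θ : ℝ, HasDerivAt (fun θ : ℝ => - (Real.sin θ ^ (2 * a + 2) * r.eval (Real.cos θ)))
      (((1 - X^2) * derivative r - C (2 * (a:ℝ) + 2) * (X * r)).eval (Real.cos θ) * Real.sin θ ^ (2 * a + 1)) θ := by
    intro θ
    have h1 := ((Real.hasDerivAt_sin θ).pow (2 * a + 2))
    have h2 := (r.hasDerivAt (Real.cos θ)).comp θ (Real.hasDerivAt_cos θ)
    have h3 := (h1.mul h2).neg
    refine h3.congr_deriv ?_
    simp only [eval_sub, eval_mul, eval_C, eval_X, eval_one, eval_pow, Function.comp]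
    have := Real.sin_sq_add_cos_sq θ
    have e : 2 * a + 2 - 1 = 2 * a + 1 := by omega
    simp only [Pi.pow_apply, e]
    push_cast
    linear_combination (eval (Real.cos θ) (derivative r)) * Real.sin θ ^ (2 * a + 1) * this
  unfold LL
  rw [intervalIntegral.integral_eq_sub_of_hasDerivAt (fun θ _ => hF θ) ((LL_cont a _).intervalIntegrable _ _)]
  simp

lemma LL_zero (a : ℕ) : LL a 0 = 0 := by simp [LL]

lemma LL_PP (a l : ℕ) : LL a (PP a (l+2)) = 0 := by
  have key : ∀ l : ℕ, (l + 2 * a + 2) * (bet a (l+1) * LL a (PP a (l+2))) = ((l:ℝ) - 1) * bet a l * LL a (PP a l) := by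
    intro l
    have h := LL_deriv a (PP a (l+1))
    have e : (1 - X^2) * derivative (PP a (l+1)) - C (2 * (a:ℝ) + 2) * (X * PP a (l+1)) =
      C (((l:ℝ) - 1) * bet a l) * PP a l - C ((l + 2 * a + 2) * bet a (l+1)) * PP a (l+2) := by
      have h1 := deriv_PP a l
      have h2 := rec2 a l
      simp only [C_mul, C_add, C_sub, C_pow, C_ofNat, C_1] at *
      linear_combination h1 + (C (l:ℝ) + 2 * C (a:ℝ) + 2) * h2
    rw [e, LL_sub, LL_C, LL_C] at h
    linarith
  have fin : ∀ l : ℕ, ((l:ℝ) - 1) * bet a l * LL a (PP a l) = 0 → LL a (PP a (l+2)) = 0 := by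
    intro l h
    have := key l
    rw [h] at this
    have h1 : (0:ℝ) < l + 2 * a + 2 := by positivity
    have h2 := bet_pos a l
    have h3 := (mul_eq_zero.mp this).resolve_left h1.ne'
    exact (mul_eq_zero.mp h3).resolve_left h2.ne'
  induction l using Nat.twoStepInduction with
  | zero => apply fin; simp [bet]
  | one => apply fin; simp
  | more l h1 h2 => apply fin; rw [h1]; simp

lemma b0_sq (a : ℕ) : (∫ θ in (0:ℝ)..Real.pi, Real.sin θ ^ (2 * a + 1)) = 2 * b a 0 ^ 2 := by
  rw [integral_sin_pow_odd]
  congr 1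
  have hp : ∀ a : ℕ, b a 0 ^ 2 = Real.sqrt Real.pi * Real.Gamma (a + 1) / (2 * Real.Gamma (a + 3 / 2)) := by
    intro a
    have h1 : 0 < Real.Gamma ((a:ℝ) + 1) := Real.Gamma_pos_of_pos (by positivity)
    have h2 : 0 < Real.Gamma ((a:ℝ) + 3/2) := Real.Gamma_pos_of_pos (by positivity)
    have h3 := Real.pi_pos
    unfold b
    rw [Real.sq_sqrt (by positivity)]
  rw [hp]
  have h3 := Real.pi_pos
  induction a with
  | zero =>
    have : Real.Gamma (((0:ℕ):ℝ) + 3/2) = 1/2 * Real.sqrt Real.pi := by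
      rw [show ((0:ℕ):ℝ) + 3/2 = 1/2 + 1 by norm_num, Real.Gamma_add_one (by norm_num), Real.Gamma_one_half_eq]
    rw [this]
    simp
    field_simp
  | succ a ih =>
    rw [Finset.prod_range_succ, ih]
    push_cast
    have h1 : 0 < Real.Gamma ((a:ℝ) + 1) := Real.Gamma_pos_of_pos (by positivity)
    have h2 : 0 < Real.Gamma ((a:ℝ) + 3/2) := Real.Gamma_pos_of_pos (by positivity)
    rw [show (a:ℝ) + 1 + 3/2 = (a + 3/2) + 1 by ring, Real.Gamma_add_one (by positivity : (a:ℝ)+1 ≠ 0),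
      Real.Gamma_add_one (by positivity : (a:ℝ)+3/2 ≠ 0)]
    field_simp

lemma LL_PP_one (a j : ℕ) : LL a (PP a 1 * PP a (j+1)) = if j = 0 then 2 else 0 := by
  have hb := (b_pos a 0).ne'
  cases j with
  | zero =>
    have : PP a 1 * PP a (0+1) = C (1 / b a 0 * (1 / b a 0)) * 1 := by
      simp only [PP, C_mul, zero_add, mul_one]
    rw [this, LL_C]
    have h := b0_sq a
    unfold LL
    simp only [eval_one, one_mul, h]
    simp
    field_simp
  | succ j =>
    rw [PP, LL_C, LL_PP]; simp

lemma LL_orth (a i j : ℕ) : LL a (PP a i * PP a j) = if i = j ∧ i ≠ 0 then 2 else 0 := by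
  induction i using Nat.twoStepInduction generalizing j with
  | zero => simp [PP, LL_zero]
  | one =>
    cases j with
    | zero => simp [PP, LL_zero]
    | succ j => rw [LL_PP_one]; simp [eq_comm]
  | more i h1 h2 =>
    have hb := (bet_pos a i).ne'
    cases j with
    | zero => simp [PP, LL_zero]
    | succ j =>
    apply mul_left_cancel₀ hb
    rw [← LL_C]
    have r1 := rec2 a i
    have r2 := rec2 a j
    have e : C (bet a (i+1)) * (PP a (i+2) * PP a (j+1)) =
        C (bet a (j+1)) * (PP a (i+1) * PP a (j+2)) + C (bet a j) * (PP a (i+1) * PP a j)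
        - C (bet a i) * (PP a i * PP a (j+1)) := by
      linear_combination (PP a (j+1)) * r1 - PP a (i+1) * r2
    rw [e, LL_sub, LL_add, LL_C, LL_C, LL_C, h1, h2, h2]
    by_cases c1 : i = j + 1
    · subst c1
      have : ¬ (j + 1 + 1 = j) := by omega
      simp [this]
    · by_cases c2 : i + 1 = j
      · subst c2
        simp [c1]
      · have c3 : ¬ (i + 1 = j + 2) := by omega
        have c4 : ¬ (i + 2 = j + 1) := by omega
        simp [c1, c2, c3, c4]

end OrthoPoly

lemma continuous_p (a l : ℕ) : Continuous (p (a : ℝ) l) := by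
  have : p (a : ℝ) l = fun x => (PP a (l+1)).eval x := by
    ext x; rw [eval_PP]
  rw [this]
  exact (PP a (l+1)).continuous

lemma theta_integral (a i j : ℕ) :
    (∫ θ in Set.Icc 0 Real.pi, p a i (Real.cos θ) * p a j (Real.cos θ) * Real.sin θ ^ (2 * a + 1)) =
      if i = j then 2 else 0 := by
  rw [integral_Icc_eq_integral_Ioc, ← intervalIntegral.integral_of_le Real.pi_pos.le]
  have h := LL_orth a (i+1) (j+1)
  unfold LL at h
  simp only [Polynomial.eval_mul, eval_PP] at h
  rw [h]
  simp

lemma phi_integral (k : ℤ) :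
    (∫ φ in Set.Icc 0 (2 * Real.pi), Complex.exp (Complex.I * k * (φ : ℝ))) =
      if k = 0 then 2 * (Real.pi : ℂ) else 0 := by
  rw [integral_Icc_eq_integral_Ioc, ← intervalIntegral.integral_of_le (by positivity)]
  split_ifs with h
  · simp [h]
  · rw [integral_exp_mul_complex (by simp [h])]
    have : Complex.exp (Complex.I * k * ((2 * Real.pi : ℝ) : ℂ)) = 1 := by
      rw [Complex.exp_eq_one_iff]
      exact ⟨k, by push_cast; ring⟩
    rw [this]
    simp

lemma inner2_Mpow_Y (j l l' : ℕ) (k k' : ℤ) :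
    inner2 (Mpow j (Y l k)) (Y l' k') = (1 / (4 * Real.pi)) *
      ((∫ θ in Set.Icc 0 Real.pi, ((Real.cos θ ^ j * (Real.sin θ ^ k.natAbs *
        p (k.natAbs : ℝ) (l - k.natAbs) (Real.cos θ)) * (Real.sin θ ^ k'.natAbs *
        p (k'.natAbs : ℝ) (l' - k'.natAbs) (Real.cos θ)) * Real.sin θ : ℝ) : ℂ)) *
      ∫ φ in Set.Icc 0 (2 * Real.pi), Complex.exp (Complex.I * (k - k' : ℤ) * (φ : ℝ))) := by
  unfold inner2 region
  congr 1
  rw [← setIntegral_prod_mul]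
  congr 1
  ext q
  have h : (starRingEnd ℂ) (Complex.exp (Complex.I * k' * (q.2 : ℝ))) =
      Complex.exp (- (Complex.I * k' * (q.2 : ℝ))) := by
    rw [← Complex.exp_conj]
    congr 1
    simp
  have h2 : Complex.exp (Complex.I * (k - k' : ℤ) * (q.2 : ℝ)) =
      Complex.exp (Complex.I * k * (q.2 : ℝ)) * Complex.exp (- (Complex.I * k' * (q.2 : ℝ))) := by
    rw [← Complex.exp_add]
    congr 1
    push_cast; ring
  rw [h2]
  simp only [Mpow, Y, map_mul, h, Complex.conj_ofReal]
  push_cast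
  ring

lemma inner2_Mpow_Y_ne (j l l' : ℕ) (k k' : ℤ) (h : k ≠ k') :
    inner2 (Mpow j (Y l k)) (Y l' k') = 0 := by
  rw [inner2_Mpow_Y, phi_integral, if_neg (sub_ne_zero.mpr h)]
  simp

lemma Mpow_zero (f : ℝ → ℝ → ℂ) : Mpow 0 f = f := by
  ext θ φ; simp [Mpow]

lemma Mpow_one (f : ℝ → ℝ → ℂ) : Mpow 1 f = Mop f := by
  ext θ φ; simp [Mpow, Mop]

lemma inner2_Y (l l' : ℕ) (k k' : ℤ) (hl : k.natAbs ≤ l) (hl' : k'.natAbs ≤ l') :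
    inner2 (Y l k) (Y l' k') = if l = l' ∧ k = k' then 1 else 0 := by
  by_cases h : k = k'
  · subst h
    rw [← Mpow_zero (Y l k), inner2_Mpow_Y, phi_integral, integral_complex_ofReal]
    have e := theta_integral k.natAbs (l - k.natAbs) (l' - k.natAbs)
    have e2 : (∫ θ in Set.Icc 0 Real.pi, (Real.cos θ ^ 0 * (Real.sin θ ^ k.natAbs *
        p (k.natAbs : ℝ) (l - k.natAbs) (Real.cos θ)) * (Real.sin θ ^ k.natAbs *
        p (k.natAbs : ℝ) (l' - k.natAbs) (Real.cos θ)) * Real.sin θ : ℝ)) =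
        if l = l' then 2 else 0 := by
      have hiff : (l - k.natAbs = l' - k.natAbs) ↔ (l = l') := by omega
      simp only [hiff] at e
      rw [← e]
      congr 1; ext θ; ring
    rw [e2]
    have : (Real.pi : ℂ) ≠ 0 := by exact_mod_cast Real.pi_pos.ne'
    by_cases hh : l = l'
    · simp [hh]; field_simp; norm_num
    · simp [hh]
  · rw [← Mpow_zero (Y l k), inner2_Mpow_Y_ne _ _ _ _ _ h]
    simp [h]

lemma continuous_Y (l : ℕ) (k : ℤ) : Continuous (fun q : ℝ × ℝ => Y l k q.1 q.2) := by
  unfold Y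
  have := continuous_p k.natAbs (l - k.natAbs)
  fun_prop

/-- normalized surface measure in coordinates -/
def mu : Measure (ℝ × ℝ) :=
  (volume.restrict region).withDensity (fun q => ENNReal.ofReal (Real.sin q.1 / (4 * Real.pi)))

/-- uncurrying -/
def unc (f : ℝ → ℝ → ℂ) : ℝ × ℝ → ℂ := fun q => f q.1 q.2

lemma region_meas : MeasurableSet region := measurableSet_Icc.prod measurableSet_Icc

lemma dens_eq : ∀ q ∈ region, (ENNReal.ofReal (Real.sin q.1 / (4 * Real.pi))).toReal =
    Real.sin q.1 / (4 * Real.pi) := by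
  intro q hq
  apply ENNReal.toReal_ofReal
  have := Real.sin_nonneg_of_mem_Icc hq.1
  have := Real.pi_pos
  positivity

lemma dens_meas : Measurable (fun q : ℝ × ℝ => ENNReal.ofReal (Real.sin q.1 / (4 * Real.pi))) := by
  fun_prop

lemma inner2_eq (f g : ℝ → ℝ → ℂ) :
    inner2 f g = ∫ q, unc f q * (starRingEnd ℂ) (unc g q) ∂mu := by
  unfold inner2 mu
  rw [integral_withDensity_eq_integral_toReal_smul dens_meas (by simp), ← integral_const_mul]
  apply setIntegral_congr_fun region_meas
  intro q hq
  simp only [dens_eq q hq, unc, Complex.real_smul]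
  push_cast
  ring

lemma memLp_of_MemL2 {f : ℝ → ℝ → ℂ} (hf : MemL2 f) : MemLp (unc f) 2 mu := by
  have hm : Measurable (unc f) := hf.1
  rw [memLp_two_iff_integrable_sq_norm hm.aestronglyMeasurable]
  unfold mu
  rw [integrable_withDensity_iff_integrable_smul' dens_meas (by simp)]
  have h2 : IntegrableOn (fun q : ℝ × ℝ => (1 / (4 * Real.pi)) * (‖f q.1 q.2‖ ^ 2 * Real.sin q.1)) region :=
    hf.2.const_mul _
  refine IntegrableOn.congr_fun h2 ?_ region_meas
  intro q hq
  simp only [dens_eq q hq, unc, smul_eq_mul]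
  ring

lemma MemL2_of_cont {f : ℝ → ℝ → ℂ} (hf : Continuous (unc f)) : MemL2 f := by
  refine ⟨hf.measurable, ?_⟩
  apply ContinuousOn.integrableOn_compact (isCompact_Icc.prod isCompact_Icc)
  have : Continuous (fun q : ℝ × ℝ => f q.1 q.2) := hf
  fun_prop

lemma Pr_cont (n m : ℕ) (f : ℝ → ℝ → ℂ) : Continuous (unc (Pr n m f)) := by
  unfold unc Pr
  refine continuous_finset_sum _ fun l _ => continuous_finset_sum _ fun k _ => ?_
  exact continuous_const.mul (continuous_Y l k)

lemma Pr_MemL2 (n m : ℕ) (f : ℝ → ℝ → ℂ) : MemL2 (Pr n m f) := MemL2_of_cont (Pr_cont n m f)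

lemma Mpow_MemL2 (j : ℕ) {f : ℝ → ℝ → ℂ} (hf : MemL2 f) : MemL2 (Mpow j f) := by
  have hm : Measurable (fun q : ℝ × ℝ => Mpow j f q.1 q.2) := by
    have := hf.1
    unfold Mpow
    fun_prop
  refine ⟨hm, ?_⟩
  refine Integrable.mono hf.2 ?_ ?_
  · apply Measurable.aestronglyMeasurable
    fun_prop
  · refine ae_of_all _ fun q => ?_
    simp only [Mpow, norm_mul, norm_pow, Complex.norm_real, Real.norm_eq_abs, abs_abs, abs_pow, abs_mul]
    have : |Real.cos q.1| ≤ 1 := Real.abs_cos_le_one _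
    have h1 : |Real.cos q.1| ^ j ≤ 1 := pow_le_one₀ (abs_nonneg _) this
    have h2 : |Real.cos q.1| ^ j * ‖f q.1 q.2‖ ≤ ‖f q.1 q.2‖ :=
      mul_le_of_le_one_left (norm_nonneg _) h1
    gcongr
    simpa only [abs_norm] using h2

/-- the class in `L²` -/
def cl {f : ℝ → ℝ → ℂ} (hf : MemL2 f) : Lp ℂ 2 mu := (memLp_of_MemL2 hf).toLp (unc f)

lemma inner2_cl {f g : ℝ → ℝ → ℂ} (hf : MemL2 f) (hg : MemL2 g) :
    inner2 f g = inner ℂ (cl hg) (cl hf) := by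
  rw [inner2_eq, L2.inner_def]
  apply integral_congr_ae
  filter_upwards [(memLp_of_MemL2 hf).coeFn_toLp, (memLp_of_MemL2 hg).coeFn_toLp] with q h1 h2
  unfold cl
  rw [h1, h2]
  simp [mul_comm]

lemma norm2_cl {f : ℝ → ℝ → ℂ} (hf : MemL2 f) : norm2 f = ‖cl hf‖ := by
  unfold norm2
  have h : (inner ℂ (cl hf) (cl hf) : ℂ).re = ‖cl hf‖ ^ 2 := inner_self_eq_norm_sq (𝕜 := ℂ) (cl hf)
  rw [inner2_cl hf hf, h]
  exact Real.sqrt_sq (norm_nonneg _)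

lemma MemL2_add {f g : ℝ → ℝ → ℂ} (hf : MemL2 f) (hg : MemL2 g) : MemL2 (f + g) := by
  have hfm := hf.1
  have hgm := hg.1
  have hm : Measurable (fun q : ℝ × ℝ => (f + g) q.1 q.2) := hfm.add hgm
  refine ⟨hm, ?_⟩
  have h : IntegrableOn (fun q : ℝ × ℝ => 2 * (‖f q.1 q.2‖ ^ 2 * Real.sin q.1) +
      2 * (‖g q.1 q.2‖ ^ 2 * Real.sin q.1)) region := (hf.2.const_mul 2).add (hg.2.const_mul 2)
  refine Integrable.mono h ?_ ?_
  · apply Measurable.aestronglyMeasurable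
    fun_prop
  · refine (ae_restrict_iff' region_meas).mpr (ae_of_all _ fun q hq => ?_)
    have hs := Real.sin_nonneg_of_mem_Icc hq.1
    rw [Real.norm_of_nonneg (by positivity), Real.norm_of_nonneg (by positivity)]
    have h1 : ‖(f + g) q.1 q.2‖ ≤ ‖f q.1 q.2‖ + ‖g q.1 q.2‖ := norm_add_le _ _
    have h2 : ‖(f + g) q.1 q.2‖ ^ 2 ≤ (‖f q.1 q.2‖ + ‖g q.1 q.2‖) ^ 2 := by gcongr
    have h3 : ‖(f + g) q.1 q.2‖ ^ 2 ≤ 2 * ‖f q.1 q.2‖ ^ 2 + 2 * ‖g q.1 q.2‖ ^ 2 := by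
      nlinarith [sq_nonneg (‖f q.1 q.2‖ - ‖g q.1 q.2‖)]
    nlinarith [mul_le_mul_of_nonneg_right h3 hs]

lemma MemL2_smul (c : ℂ) {f : ℝ → ℝ → ℂ} (hf : MemL2 f) : MemL2 (c • f) := by
  have hfm := hf.1
  refine ⟨hfm.const_smul c, ?_⟩
  have h := hf.2.const_mul (‖c‖ ^ 2)
  refine h.congr (ae_of_all _ fun q => ?_)
  simp only [Pi.smul_apply, norm_smul]
  ring

lemma MemL2_zero : MemL2 0 := MemL2_of_cont (f := 0) continuous_const

lemma Y_MemL2 (l : ℕ) (k : ℤ) : MemL2 (Y l k) := MemL2_of_cont (continuous_Y l k)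

lemma MemL2_sub {f g : ℝ → ℝ → ℂ} (hf : MemL2 f) (hg : MemL2 g) : MemL2 (f - g) := by
  have := MemL2_add hf (MemL2_smul (-1) hg)
  rwa [neg_one_smul, ← sub_eq_add_neg] at this

lemma cl_add {f g : ℝ → ℝ → ℂ} (hf : MemL2 f) (hg : MemL2 g) (h : MemL2 (f + g)) :
    cl h = cl hf + cl hg := rfl

lemma cl_smul (c : ℂ) {f : ℝ → ℝ → ℂ} (hf : MemL2 f) (h : MemL2 (c • f)) :
    cl h = c • cl hf := rfl

lemma cl_sub {f g : ℝ → ℝ → ℂ} (hf : MemL2 f) (hg : MemL2 g) (h : MemL2 (f - g)) :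
    cl h = cl hf - cl hg := rfl

lemma inner2_add {f g h : ℝ → ℝ → ℂ} (hf : MemL2 f) (hg : MemL2 g) (hh : MemL2 h) :
    inner2 (f + g) h = inner2 f h + inner2 g h := by
  rw [inner2_cl (MemL2_add hf hg) hh, inner2_cl hf hh, inner2_cl hg hh, cl_add hf hg, inner_add_right]

lemma inner2_smul (c : ℂ) {f h : ℝ → ℝ → ℂ} (hf : MemL2 f) (hh : MemL2 h) :
    inner2 (c • f) h = c * inner2 f h := by
  rw [inner2_cl (MemL2_smul c hf) hh, inner2_cl hf hh, cl_smul c hf, inner_smul_right]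

lemma norm2_sub_le {f g : ℝ → ℝ → ℂ} (hf : MemL2 f) (hg : MemL2 g) :
    norm2 (f - g) ≤ norm2 f + norm2 g := by
  rw [norm2_cl (MemL2_sub hf hg), norm2_cl hf, norm2_cl hg, cl_sub hf hg]
  exact norm_sub_le _ _

lemma norm2_Mpow_le (j : ℕ) {f : ℝ → ℝ → ℂ} (hf : MemL2 f) : norm2 (Mpow j f) ≤ norm2 f := by
  rw [norm2_cl (Mpow_MemL2 j hf), norm2_cl hf]
  apply Lp.norm_le_norm_of_ae_le
  filter_upwards [(memLp_of_MemL2 hf).coeFn_toLp, (memLp_of_MemL2 (Mpow_MemL2 j hf)).coeFn_toLp] with q h1 h2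
  unfold cl
  rw [h1, h2]
  simp only [unc, Mpow, norm_mul, norm_pow, Complex.norm_real, Real.norm_eq_abs]
  exact mul_le_of_le_one_left (norm_nonneg _) (pow_le_one₀ (abs_nonneg _) (Real.abs_cos_le_one _))

/-- index set of the spherical harmonics -/
abbrev Idx : Type := {i : ℕ × ℤ // i.2.natAbs ≤ i.1}

/-- the harmonics in `L²` -/
def yv (i : Idx) : Lp ℂ 2 mu := cl (Y_MemL2 i.1.1 i.1.2)

lemma yv_orthonormal : Orthonormal ℂ yv := by
  classical
  rw [orthonormal_iff_ite]
  intro i j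
  unfold yv
  rw [← inner2_cl, inner2_Y _ _ _ _ j.2 i.2]
  congr 1
  rw [eq_iff_iff, Subtype.ext_iff, Prod.ext_iff]
  constructor <;> (rintro ⟨h1, h2⟩; exact ⟨h1.symm, h2.symm⟩)

/-- index finset -/
def IS (n m : ℕ) : Finset (ℕ × ℤ) :=
  (Finset.Icc m n).biUnion fun l => (Finset.Icc (-(l : ℤ)) (l : ℤ)).image fun k => (l, k)

lemma mem_IS {n m : ℕ} {i : ℕ × ℤ} : i ∈ IS n m ↔ m ≤ i.1 ∧ i.1 ≤ n ∧ i.2.natAbs ≤ i.1 := by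
  unfold IS
  simp only [Finset.mem_biUnion, Finset.mem_image, Finset.mem_Icc]
  constructor
  · rintro ⟨l, ⟨h1, h2⟩, k, ⟨h3, h4⟩, rfl⟩
    exact ⟨h1, h2, by simp only; omega⟩
  · rintro ⟨h1, h2, h3⟩
    exact ⟨i.1, ⟨h1, h2⟩, i.2, by omega, rfl⟩

lemma Pr_eq (n m : ℕ) (f : ℝ → ℝ → ℂ) :
    Pr n m f = ∑ i ∈ IS n m, inner2 f (Y i.1 i.2) • Y i.1 i.2 := by
  ext θ φ
  simp only [Finset.sum_apply, Pi.smul_apply, smul_eq_mul]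
  unfold Pr IS
  rw [Finset.sum_biUnion]
  · refine Finset.sum_congr rfl fun l _ => ?_
    rw [Finset.sum_image]
    intro a _ b _ h
    exact (Prod.ext_iff.mp h).2
  · intro a _ b _ hab
    rw [Function.onFun, Finset.disjoint_left]
    intro x hx hy
    simp only [Finset.mem_image] at hx hy
    obtain ⟨k, _, rfl⟩ := hx
    obtain ⟨k', _, h⟩ := hy
    exact hab (Prod.ext_iff.mp h).1.symm

lemma MemL2_sum {ι : Type} (s : Finset ι) (c : ι → ℂ) (g : ι → ℝ → ℝ → ℂ) (hg : ∀ i, MemL2 (g i))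
    : ∃ h : MemL2 (∑ i ∈ s, c i • g i), cl h = ∑ i ∈ s, c i • cl (hg i) := by
  classical
  induction s using Finset.induction_on with
  | empty => exact ⟨by simpa using MemL2_zero, by simp; rfl⟩
  | insert a s ha ih =>
    obtain ⟨h, e⟩ := ih
    have h2 := MemL2_add (MemL2_smul (c a) (hg a)) h
    have e2 := cl_add (MemL2_smul (c a) (hg a)) h h2
    simp only [Finset.sum_insert ha]
    exact ⟨h2, by rw [e2, e]; rfl⟩

lemma norm2_Pr_le (n m : ℕ) {f : ℝ → ℝ → ℂ} (hf : MemL2 f) : norm2 (Pr n m f) ≤ norm2 f := by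
  classical
  let s : Finset Idx := (IS n m).subtype _
  have e : Pr n m f = ∑ i ∈ s, inner2 f (Y i.1.1 i.1.2) • Y i.1.1 i.1.2 := by
    rw [Pr_eq]
    rw [Finset.sum_subtype_of_mem (fun i : ℕ × ℤ => inner2 f (Y i.1 i.2) • Y i.1 i.2)]
    intro x hx
    exact (mem_IS.mp hx).2.2
  obtain ⟨h, hc⟩ := MemL2_sum s (fun i => inner2 f (Y i.1.1 i.1.2)) (fun i => Y i.1.1 i.1.2)
    (fun i => Y_MemL2 _ _)
  rw [e, norm2_cl h, norm2_cl hf]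
  have hB := yv_orthonormal.sum_inner_products_le (x := cl hf) (s := s)
  have hN : ‖cl h‖ ^ 2 = ∑ i ∈ s, ‖inner ℂ (yv i) (cl hf)‖ ^ 2 := by
    have h1 : inner ℂ (cl h) (cl h) = ∑ i ∈ s, (starRingEnd ℂ) (inner2 f (Y i.1.1 i.1.2)) * inner2 f (Y i.1.1 i.1.2) := by
      rw [hc]
      exact yv_orthonormal.inner_sum _ _ s
    rw [inner_self_eq_norm_sq_to_K] at h1
    have h2 : ((‖cl h‖ ^ 2 : ℝ) : ℂ) = ((∑ i ∈ s, ‖inner ℂ (yv i) (cl hf)‖ ^ 2 : ℝ) : ℂ) := by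
      push_cast
      refine Eq.trans h1 (Finset.sum_congr rfl fun i _ => ?_)
      rw [inner2_cl hf (Y_MemL2 _ _)]
      exact Complex.conj_mul' _
    exact_mod_cast h2
  exact le_of_sq_le_sq (by rw [hN]; exact hB) (norm_nonneg _)

/-- index set of the low-order block -/
def GS (n m : ℕ) : Finset (ℕ × ℤ) := (IS n 0).filter fun i => i.2.natAbs < m

lemma mem_GS {n m : ℕ} {i : ℕ × ℤ} : i ∈ GS n m ↔ i.1 ≤ n ∧ i.2.natAbs ≤ i.1 ∧ i.2.natAbs < m := by
  unfold GS
  rw [Finset.mem_filter, mem_IS]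
  omega

lemma card_GS (n M : ℕ) (h : M ≤ n) : (GS n (M+1)).card + M * (M + 1) = (2 * M + 1) * (n + 1) := by
  have key : ∀ k : ℕ, k ≤ n → ((Finset.Icc k n).card : ℤ) = n + 1 - k := by
    intro k hk
    rw [Nat.card_Icc]; omega
  induction M with
  | zero =>
    have : GS n 1 = (Finset.Icc 0 n).image fun l => (l, (0:ℤ)) := by
      ext ⟨l, k⟩
      rw [mem_GS]
      simp only [Finset.mem_image, Finset.mem_Icc, Prod.mk.injEq]
      constructor
      · rintro ⟨h1, h2, h3⟩; exact ⟨l, by omega, rfl, by omega⟩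
      · rintro ⟨l', h1, rfl, rfl⟩; simp; omega
    rw [this, Finset.card_image_of_injective _ (fun a b h => (Prod.ext_iff.mp h).1)]
    simp
  | succ M ih =>
    have ih := ih (by omega)
    have e : GS n (M+1+1) = GS n (M+1) ∪ ((Finset.Icc (M+1) n).image (fun l => (l, ((M:ℤ)+1))) ∪
        (Finset.Icc (M+1) n).image (fun l => (l, -((M:ℤ)+1)))) := by
      ext ⟨l, k⟩
      simp only [Finset.mem_union, mem_GS, Finset.mem_image, Finset.mem_Icc, Prod.mk.injEq]
      constructor
      · rintro ⟨h1, h2, h3⟩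
        by_cases c : k.natAbs < M + 1
        · left; omega
        · right
          by_cases d : 0 ≤ k
          · left; exact ⟨l, by omega, rfl, by omega⟩
          · right; exact ⟨l, by omega, rfl, by omega⟩
      · rintro (h | ⟨l', h1, rfl, rfl⟩ | ⟨l', h1, rfl, rfl⟩) <;> omega
    rw [e, Finset.card_union_of_disjoint, Finset.card_union_of_disjoint,
      Finset.card_image_of_injective _ (fun a b h => (Prod.ext_iff.mp h).1),
      Finset.card_image_of_injective _ (fun a b h => (Prod.ext_iff.mp h).1), Nat.card_Icc]
    · zify [show M + 1 ≤ n + 1 by omega] at ih ⊢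
      push_cast at ih ⊢
      linear_combination ih
    · rw [Finset.disjoint_left]
      rintro ⟨l, k⟩ h1 h2
      simp only [Finset.mem_image, Prod.mk.injEq] at h1 h2
      obtain ⟨_, _, _, h1⟩ := h1
      obtain ⟨_, _, _, h2⟩ := h2
      omega
    · rw [Finset.disjoint_left]
      rintro ⟨l, k⟩ h1 h2
      rw [mem_GS] at h1
      simp only [Finset.mem_union, Finset.mem_image, Prod.mk.injEq] at h1 h2
      rcases h2 with ⟨_, _, _, h2⟩ | ⟨_, _, _, h2⟩ <;> omega

/-- the low-order block -/
def VV (n m : ℕ) : Submodule ℂ (ℝ → ℝ → ℂ) :=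
  Submodule.span ℂ ((fun i : ℕ × ℤ => Y i.1 i.2) '' (GS n m : Set (ℕ × ℤ)))

lemma Y_mem_VV {n m : ℕ} {i : ℕ × ℤ} (h : i ∈ GS n m) : Y i.1 i.2 ∈ VV n m :=
  Submodule.subset_span ⟨i, h, rfl⟩

lemma VV_range (n m : ℕ) (hm : 1 ≤ m) (hmn : m ≤ n) :
    ∃ g : Fin ((2 * m - 1) * (n + 1) - m * (m - 1)) → (ℝ → ℝ → ℂ),
      Submodule.span ℂ (Set.range g) = VV n m := by
  obtain ⟨M, rfl⟩ : ∃ M, m = M + 1 := ⟨m - 1, by omega⟩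
  have hc := card_GS n M (by omega)
  have hc2 : (GS n (M+1)).card = (2 * (M+1) - 1) * (n + 1) - (M+1) * (M + 1 - 1) := by
    rw [show 2 * (M+1) - 1 = 2 * M + 1 by omega, Nat.add_sub_cancel, ← hc, mul_comm (M+1) M]
    omega
  let eq := (GS n (M+1)).equivFinOfCardEq hc2
  refine ⟨fun i => Y (eq.symm i).1.1 (eq.symm i).1.2, ?_⟩
  unfold VV
  congr 1
  ext f
  constructor
  · rintro ⟨i, rfl⟩
    exact ⟨(eq.symm i).1, (eq.symm i).2, rfl⟩
  · rintro ⟨i, hi, rfl⟩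
    exact ⟨eq ⟨i, hi⟩, by simp⟩

lemma VV_MemL2 {n m : ℕ} {f : ℝ → ℝ → ℂ} (hf : f ∈ VV n m) : MemL2 f := by
  induction hf using Submodule.span_induction with
  | mem x h => obtain ⟨i, _, rfl⟩ := h; exact Y_MemL2 _ _
  | zero => exact MemL2_zero
  | add x y _ _ hx hy => exact MemL2_add hx hy
  | smul c x _ hx => exact MemL2_smul c hx

lemma Pr_add (n m : ℕ) {f g : ℝ → ℝ → ℂ} (hf : MemL2 f) (hg : MemL2 g) :
    Pr n m (f + g) = Pr n m f + Pr n m g := by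
  rw [Pr_eq, Pr_eq, Pr_eq, ← Finset.sum_add_distrib]
  refine Finset.sum_congr rfl fun i _ => ?_
  rw [inner2_add hf hg (Y_MemL2 _ _), add_smul]

lemma Pr_smul (n m : ℕ) (c : ℂ) {f : ℝ → ℝ → ℂ} (hf : MemL2 f) :
    Pr n m (c • f) = c • Pr n m f := by
  rw [Pr_eq, Pr_eq, Finset.smul_sum]
  refine Finset.sum_congr rfl fun i _ => ?_
  rw [inner2_smul c hf (Y_MemL2 _ _), mul_smul]

lemma Mpow_add (j : ℕ) (f g : ℝ → ℝ → ℂ) : Mpow j (f + g) = Mpow j f + Mpow j g := by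
  ext θ φ; simp [Mpow, mul_add]

lemma Mpow_smul (j : ℕ) (c : ℂ) (f : ℝ → ℝ → ℂ) : Mpow j (c • f) = c • Mpow j f := by
  ext θ φ; simp [Mpow]; ring

lemma Pr_Mpow_VV (n m j : ℕ) {f : ℝ → ℝ → ℂ} (hf : f ∈ VV n m) : Pr n 0 (Mpow j f) ∈ VV n m := by
  induction hf using Submodule.span_induction with
  | mem x h =>
    obtain ⟨i, hi, rfl⟩ := h
    rw [Pr_eq]
    refine Submodule.sum_mem _ fun i' hi' => ?_
    by_cases h : i.2 = i'.2
    · apply Submodule.smul_mem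
      apply Y_mem_VV
      have h1 := mem_GS.mp hi
      have h2 := mem_IS.mp hi'
      rw [mem_GS, ← h]
      rw [← h] at h2
      omega
    · rw [inner2_Mpow_Y_ne _ _ _ _ _ h, zero_smul]
      exact Submodule.zero_mem _
  | zero =>
    have : Mpow j 0 = (0 : ℂ) • (0 : ℝ → ℝ → ℂ) := by ext θ φ; simp [Mpow]
    rw [this, Pr_smul _ _ _ MemL2_zero, zero_smul]
    exact Submodule.zero_mem _
  | add x y hx' hy' hx hy =>
    rw [Mpow_add, Pr_add _ _ (Mpow_MemL2 j (VV_MemL2 hx')) (Mpow_MemL2 j (VV_MemL2 hy'))]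
    exact Submodule.add_mem _ hx hy
  | smul c x hx' hx =>
    rw [Mpow_smul, Pr_smul _ _ _ (Mpow_MemL2 j (VV_MemL2 hx'))]
    exact Submodule.smul_mem _ _ hx

lemma Pr_split (n m : ℕ) (f : ℝ → ℝ → ℂ) :
    ∃ h ∈ VV n m, Pr n 0 f = Pr n m f + h := by
  refine ⟨∑ i ∈ IS n 0 \ IS n m, inner2 f (Y i.1 i.2) • Y i.1 i.2, ?_, ?_⟩
  · refine Submodule.sum_mem _ fun i hi => Submodule.smul_mem _ _ (Y_mem_VV ?_)
    rw [Finset.mem_sdiff, mem_IS, mem_IS] at hi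
    rw [mem_GS]
    omega
  · rw [Pr_eq, Pr_eq, add_comm, Finset.sum_sdiff]
    intro i hi
    rw [mem_IS] at *
    omega

lemma B_mem (n m j : ℕ) (f : ℝ → ℝ → ℂ) :
    Pr n 0 (Mpow j (Pr n 0 f)) - Pr n m (Mpow j (Pr n m f)) ∈ VV n m := by
  obtain ⟨h, hV, e⟩ := Pr_split n m f
  obtain ⟨h', hV', e'⟩ := Pr_split n m (Mpow j (Pr n m f))
  rw [e, Mpow_add, Pr_add _ _ (Mpow_MemL2 j (Pr_MemL2 _ _ _)) (Mpow_MemL2 j (VV_MemL2 hV)), e']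
  rw [show ∀ x y z : ℝ → ℝ → ℂ, x + y + z - x = y + z by intro x y z; abel]
  exact Submodule.add_mem _ hV' (Pr_Mpow_VV n m j hV)

lemma SFop_eq (n m : ℕ) (f : ℝ → ℝ → ℂ) : SFop n m f = Pr n m (Mpow 1 (Pr n m f)) := by
  rw [Mpow_one]; rfl

lemma SFop_iter (n m j : ℕ) {f : ℝ → ℝ → ℂ} (hf : MemL2 f) :
    MemL2 ((SFop n m)^[j] f) ∧ norm2 ((SFop n m)^[j] f) ≤ norm2 f := by
  induction j with
  | zero => exact ⟨hf, le_refl _⟩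
  | succ j ih =>
    rw [Function.iterate_succ_apply', SFop_eq]
    refine ⟨Pr_MemL2 _ _ _, ?_⟩
    have h1 := norm2_Pr_le n m (Mpow_MemL2 1 (Pr_MemL2 n m ((SFop n m)^[j] f)))
    have h2 := norm2_Mpow_le 1 (Pr_MemL2 n m ((SFop n m)^[j] f))
    have h3 := norm2_Pr_le n m ih.1
    linarith [ih.2]

lemma C_mem (n m j : ℕ) {f : ℝ → ℝ → ℂ} (hf : MemL2 f) :
    (SFop n m)^[j] f - (SFop n 0)^[j] f ∈ VV n m := by
  induction j with
  | zero => simp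
  | succ j ih =>
    rw [Function.iterate_succ_apply', Function.iterate_succ_apply']
    have hu := (SFop_iter n m j hf).1
    have hv := (SFop_iter n 0 j hf).1
    set u := (SFop n m)^[j] f
    set v := (SFop n 0)^[j] f
    have h1 := B_mem n m 1 u
    have e : Pr n 0 u = Pr n 0 (u - v) + Pr n 0 v := by
      rw [← Pr_add _ _ (MemL2_sub hu hv) hv, sub_add_cancel]
    have h2 : SFop n 0 u = Pr n 0 (Mpow 1 (Pr n 0 (u - v))) + SFop n 0 v := by
      rw [SFop_eq, SFop_eq, e, Mpow_add, Pr_add _ _ (Mpow_MemL2 1 (Pr_MemL2 _ _ _))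
        (Mpow_MemL2 1 (Pr_MemL2 _ _ _))]
    have h3 : Pr n 0 (u - v) ∈ VV n m := by
      have := Pr_Mpow_VV n m 0 ih
      rwa [Mpow_zero] at this
    have h4 := Pr_Mpow_VV n m 1 h3
    rw [← SFop_eq, ← SFop_eq] at h1
    have h5 := Submodule.sub_mem _ h4 h1
    rw [h2] at h5
    convert h5 using 1
    abel

/-- the operators `B_j = P_n^0 M^j P_n^0 − P_n^m M^j P_n^m` and
`C_j = (P_n^m M P_n^m)^j − (P_n^0 M P_n^0)^j` each have operator norm at most `2` and
rank at most `(2m−1)(n+1) − m(m−1)`. -/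
theorem stmt14 (n m j : ℕ) (hm : 1 ≤ m) (hmn : m ≤ n) (hj : 1 ≤ j) :
    (∀ f : ℝ → ℝ → ℂ, MemL2 f →
      norm2 (fun θ φ => Pr n 0 (Mpow j (Pr n 0 f)) θ φ - Pr n m (Mpow j (Pr n m f)) θ φ) ≤
        2 * norm2 f) ∧
    (∀ f : ℝ → ℝ → ℂ, MemL2 f →
      norm2 (fun θ φ => (SFop n m)^[j] f θ φ - (SFop n 0)^[j] f θ φ) ≤ 2 * norm2 f) ∧
    (∃ g : Fin ((2 * m - 1) * (n + 1) - m * (m - 1)) → (ℝ → ℝ → ℂ),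
      ∀ f : ℝ → ℝ → ℂ, MemL2 f →
        (fun θ φ => Pr n 0 (Mpow j (Pr n 0 f)) θ φ - Pr n m (Mpow j (Pr n m f)) θ φ) ∈
          Submodule.span ℂ (Set.range g)) ∧
    (∃ g : Fin ((2 * m - 1) * (n + 1) - m * (m - 1)) → (ℝ → ℝ → ℂ),
      ∀ f : ℝ → ℝ → ℂ, MemL2 f →
        (fun θ φ => (SFop n m)^[j] f θ φ - (SFop n 0)^[j] f θ φ) ∈
          Submodule.span ℂ (Set.range g)) := by
  refine ⟨fun f hf => ?_, fun f hf => ?_, ?_, ?_⟩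
  · have key : ∀ m, norm2 (Pr n m (Mpow j (Pr n m f))) ≤ norm2 f := fun m =>
      (norm2_Pr_le n m (Mpow_MemL2 j (Pr_MemL2 n m f))).trans
        ((norm2_Mpow_le j (Pr_MemL2 n m f)).trans (norm2_Pr_le n m hf))
    have h := norm2_sub_le (Pr_MemL2 n 0 (Mpow j (Pr n 0 f))) (Pr_MemL2 n m (Mpow j (Pr n m f)))
    have h0 := key 0
    have h1 := key m
    refine le_trans h ?_
    linarith
  · have h := norm2_sub_le (SFop_iter n m j hf).1 (SFop_iter n 0 j hf).1
    have h0 := (SFop_iter n m j hf).2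
    have h1 := (SFop_iter n 0 j hf).2
    refine le_trans h ?_
    linarith
  · obtain ⟨g, hg⟩ := VV_range n m hm hmn
    refine ⟨g, fun f _ => ?_⟩
    rw [hg]
    exact B_mem n m j f
  · obtain ⟨g, hg⟩ := VV_range n m hm hmn
    refine ⟨g, fun f hf => ?_⟩
    rw [hg]
    exact C_mem n m j hf
end SFT
end
end

section
/- Let 0 ≤ m ≤ n and j ≥ 0 be integers. Then Σ_{l=m}^n Σ_{k=−l}^l ⟨M^j Y_l^k, Y_l^k⟩ = ((n+1)² − m²)/2 · ∫_{−1}^1 x^j dx; i.e., the trace of the operator P_n^m M^j P_n^m restricted to Π_n^m equals (N_n^m/2) ∫_{−1}^1 x^j dx. -/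
open MeasureTheory Finset

noncomputable section

namespace SFT

open Polynomial in
/-- Legendre polynomials. -/
def leg : ℕ → ℝ[X]
  | 0 => 1
  | 1 => X
  | l + 2 => C (((l : ℝ) + 2)⁻¹) * ((2 * (l : ℝ[X]) + 3) * X * leg (l + 1) - ((l : ℝ[X]) + 1) * leg l)

/-- Iterated derivatives of the Legendre polynomials. -/
def dleg (k l : ℕ) : Polynomial ℝ := Polynomial.derivative^[k] (leg l)

open Polynomial in
lemma dleg_succ (k l : ℕ) : dleg (k + 1) l = derivative (dleg k l) := by
  simp [dleg, Function.iterate_succ_apply']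

open Polynomial in
lemma leg_rec (l : ℕ) : ((l : ℝ[X]) + 2) * leg (l + 2) =
    (2 * (l : ℝ[X]) + 3) * X * leg (l + 1) - ((l : ℝ[X]) + 1) * leg l := by
  have h : ((l : ℝ[X]) + 2) = C ((l : ℝ) + 2) := by simp; rfl
  have h0 : ((l : ℝ) + 2) ≠ 0 := by positivity
  rw [leg, h, ← mul_assoc, ← C_mul, mul_inv_cancel₀ h0, C_1, one_mul]

open Polynomial in
lemma leg_eval_one (l : ℕ) : (leg l).eval 1 = 1 := by
  induction l using Nat.strong_induction_on with
  | _ l ih =>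
    match l with
    | 0 => simp [leg]
    | 1 => simp [leg]
    | l + 2 =>
      have h := congrArg (eval 1) (leg_rec l)
      simp only [eval_mul, eval_add, eval_sub, eval_natCast, eval_ofNat, eval_X, eval_one,
        ih (l + 1) (by omega), ih l (by omega)] at h
      have h0 : ((l : ℝ) + 2) ≠ 0 := by positivity
      apply mul_left_cancel₀ h0
      rw [h]; ring

open Polynomial in
lemma leg_AB (l : ℕ) :
    derivative (leg (l + 1)) = X * derivative (leg l) + ((l : ℝ[X]) + 1) * leg l ∧
    X * derivative (leg (l + 1)) - derivative (leg l) = ((l : ℝ[X]) + 1) * leg (l + 1) := by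
  induction l with
  | zero => simp [leg]
  | succ l ih =>
    obtain ⟨hA, hB⟩ := ih
    have hr := leg_rec l
    have hd := congrArg derivative hr
    simp only [derivative_mul, derivative_add, derivative_sub, derivative_natCast,
      derivative_ofNat, derivative_X, derivative_one] at hd
    have h0 : ((l : ℝ[X]) + 2) ≠ 0 := by
      have : ((l + 2 : ℕ) : ℝ[X]) ≠ 0 := Nat.cast_ne_zero.mpr (by omega)
      simpa using this
    have hA' : derivative (leg (l + 1 + 1)) =
        X * derivative (leg (l + 1)) + (((l + 1 : ℕ) : ℝ[X]) + 1) * leg (l + 1) := by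
      apply mul_left_cancel₀ h0
      push_cast
      linear_combination hd + ((l : ℝ[X]) + 1) * hB
    refine ⟨hA', ?_⟩
    rw [hA']
    push_cast
    linear_combination X * hB - hA - hr

open Polynomial in
lemma dleg_A (k l : ℕ) : dleg (k + 1) (l + 1) =
    X * dleg (k + 1) l + ((k : ℝ[X]) + (l : ℝ[X]) + 1) * dleg k l := by
  induction k with
  | zero => simpa [dleg] using (leg_AB l).1
  | succ k ih =>
    rw [dleg_succ (k + 1), ih]
    simp only [derivative_mul, derivative_add, derivative_natCast, derivative_X, derivative_one,
      ← dleg_succ]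
    push_cast
    ring

open Polynomial in
lemma dleg_B (k l : ℕ) : X * dleg (k + 1) (l + 1) - dleg (k + 1) l =
    ((l : ℝ[X]) + 1 - (k : ℝ[X])) * dleg k (l + 1) := by
  induction k with
  | zero => simpa [dleg] using (leg_AB l).2
  | succ k ih =>
    have h := congrArg derivative ih
    simp only [derivative_mul, derivative_add, derivative_sub, derivative_natCast, derivative_X,
      derivative_one, ← dleg_succ] at h
    push_cast
    linear_combination h

open Polynomial in
lemma dleg_ode (k l : ℕ) : 2 * ((k : ℝ[X]) + 1) * X * dleg (k + 1) l =
    (1 - X ^ 2) * dleg (k + 2) l + ((l : ℝ[X]) - (k : ℝ[X])) * ((l : ℝ[X]) + (k : ℝ[X]) + 1) * dleg k l := by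
  induction k with
  | zero =>
    cases l with
    | zero => simp [dleg, leg]
    | succ l =>
      obtain ⟨hA, hB⟩ := leg_AB l
      have h1 : (X ^ 2 - 1) * derivative (leg (l + 1)) =
          ((l : ℝ[X]) + 1) * (X * leg (l + 1) - leg l) := by
        linear_combination X * hB - hA
      have h2 := congrArg derivative h1
      simp only [derivative_mul, derivative_add, derivative_sub, derivative_natCast, derivative_X,
        derivative_one, derivative_X_pow] at h2
      simp only [dleg, Function.iterate_succ_apply', Function.iterate_zero, id]
      push_cast at h2 ⊢
      simp only [map_ofNat, Nat.reduceSub, pow_one] at h2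
      simp at h2
      linear_combination h2 + ((l : ℝ[X]) + 1) * hB
  | succ k ih =>
    have h := congrArg derivative ih
    simp only [derivative_mul, derivative_add, derivative_sub, derivative_natCast, derivative_X,
      derivative_one, derivative_X_pow, derivative_ofNat, ← dleg_succ] at h
    simp at h
    have hC : (C 2 : ℝ[X]) = 2 := rfl
    rw [hC] at h
    push_cast
    linear_combination h

lemma dleg_zero (l : ℕ) : ∀ k, l < k → dleg k l = 0 := by
  induction l with
  | zero =>
    intro k hk
    obtain ⟨k, rfl⟩ := Nat.exists_eq_succ_of_ne_zero (Nat.pos_iff_ne_zero.mp hk)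
    simp [dleg, leg]
  | succ l ih =>
    intro k hk
    obtain ⟨k, rfl⟩ := Nat.exists_eq_succ_of_ne_zero (show k ≠ 0 by omega)
    rw [Nat.succ_eq_add_one, dleg_A, ih (k + 1) (by omega), ih k (by omega)]
    simp

open Polynomial in
lemma dleg_rec (k i : ℕ) : ((i : ℝ[X]) + 2) * dleg k (k + i + 2) =
    (2 * ((k : ℝ[X]) + (i : ℝ[X])) + 3) * X * dleg k (k + i + 1)
      - (2 * (k : ℝ[X]) + (i : ℝ[X]) + 1) * dleg k (k + i) := by
  cases k with
  | zero => simpa [dleg] using leg_rec i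
  | succ k =>
    have hA := dleg_A k (k + 1 + i + 1)
    have hB := dleg_B k (k + 1 + i)
    push_cast at hA hB ⊢
    linear_combination ((i : ℝ[X]) + 2) * hA - (2 * (k : ℝ[X]) + (i : ℝ[X]) + 3) * hB

open Polynomial in
lemma dleg_diag (k : ℕ) : dleg (k + 1) (k + 1) = (2 * (k : ℝ[X]) + 1) * dleg k k := by
  rw [dleg_A, dleg_zero k (k + 1) (by omega)]; ring

open Polynomial in
lemma dleg_one (k : ℕ) : dleg k (k + 1) = (2 * (k : ℝ[X]) + 1) * X * dleg k k := by
  cases k with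
  | zero => simp [dleg, leg]
  | succ k =>
    have hA := dleg_A k (k + 1)
    have hB := dleg_B k k
    rw [dleg_zero k (k + 1) (by omega)] at hB
    push_cast at hA hB ⊢
    linear_combination hA - (2 * (k : ℝ[X]) + 2) * hB

/-- Coefficient `a_k` in the addition theorem. -/
def acoef (l k : ℕ) : ℝ := (Nat.factorial (l - k) : ℝ) / (Nat.factorial (l + k) : ℝ)

lemma acoef_succ (l k : ℕ) (h : k < l) :
    acoef l (k + 1) * (((l : ℝ) - k) * (l + k + 1)) = acoef l k := by
  obtain ⟨d, rfl⟩ := Nat.exists_eq_add_of_lt h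
  unfold acoef
  have e1 : k + d + 1 - (k + 1) = d := by omega
  have e2 : k + d + 1 - k = d + 1 := by omega
  have e3 : k + d + 1 + (k + 1) = (k + d + 1 + k) + 1 := by omega
  rw [e1, e2, e3, Nat.factorial_succ d, Nat.factorial_succ (k + d + 1 + k)]
  have : (Nat.factorial (k + d + 1 + k) : ℝ) ≠ 0 := by positivity
  push_cast
  field_simp
  ring

open Polynomial in
/-- The polynomial in the addition theorem. -/
def Fpoly (l N : ℕ) : ℝ[X] :=
  leg l ^ 2 + 2 * ∑ k ∈ Finset.range N, C (acoef l (k + 1)) * (1 - X ^ 2) ^ (k + 1) *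
    dleg (k + 1) l ^ 2

open Polynomial in
lemma Fpoly_deriv (l N : ℕ) (hN : N ≤ l) : derivative (Fpoly l N) =
    2 * C (acoef l N) * (1 - X ^ 2) ^ N * dleg N l * dleg (N + 1) l := by
  induction N with
  | zero =>
    have : acoef l 0 = 1 := by
      unfold acoef; simp [div_self (Nat.cast_ne_zero.mpr (Nat.factorial_ne_zero l) : (Nat.factorial l : ℝ) ≠ 0)]
    simp [Fpoly, dleg, this]
    rw [pow_two, derivative_mul]; ring
  | succ N ih =>
    have hs : Fpoly l (N + 1) = Fpoly l N + 2 * (C (acoef l (N + 1)) * (1 - X ^ 2) ^ (N + 1) *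
        dleg (N + 1) l ^ 2) := by
      unfold Fpoly; rw [Finset.sum_range_succ]; ring
    rw [hs, derivative_add, ih (by omega), ← acoef_succ l N (by omega)]
    have hode := dleg_ode N l
    have hp : derivative ((1 - X ^ 2 : ℝ[X]) ^ (N + 1)) =
        -(2 * ((N : ℝ[X]) + 1) * X * (1 - X ^ 2) ^ N) := by
      rw [derivative_pow_succ]; simp; ring
    have hq : derivative (dleg (N + 1) l ^ 2) = 2 * dleg (N + 1) l * dleg (N + 2) l := by
      rw [pow_two, derivative_mul, ← dleg_succ]; ring
    simp only [derivative_mul, hp, hq, derivative_C, derivative_ofNat]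
    simp only [map_mul, map_sub, map_add, map_natCast, map_one]
    linear_combination
      (-2 * C (acoef l (N + 1)) * (1 - X ^ 2) ^ N * dleg (N + 1) l) * hode

open Polynomial in
lemma Fpoly_eval (l : ℕ) (x : ℝ) : (Fpoly l l).eval x = 1 := by
  have h : derivative (Fpoly l l) = 0 := by
    rw [Fpoly_deriv l l le_rfl, dleg_zero l (l + 1) (by omega)]; simp
  have h2 := eq_C_of_derivative_eq_zero h
  have h1 : (Fpoly l l).eval 1 = 1 := by
    simp [Fpoly, leg_eval_one, eval_finsetSum]
  rw [h2] at h1 ⊢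
  simpa using h1

/-- Normalization constant. -/
def rr (k i : ℕ) : ℝ := (2 * ((k : ℝ) + i) + 1) * (Nat.factorial i : ℝ) / (Nat.factorial (i + 2 * k) : ℝ)

lemma rr_pos (k i : ℕ) : 0 < rr k i := by unfold rr; positivity

lemma rr_succ (k i : ℕ) : rr k (i + 1) * ((2 * ((k : ℝ) + i) + 1) * (i + 1 + 2 * k)) =
    rr k i * ((2 * ((k : ℝ) + i) + 3) * (i + 1)) := by
  unfold rr
  have e : i + 1 + 2 * k = (i + 2 * k) + 1 := by omega
  rw [e, Nat.factorial_succ, Nat.factorial_succ (i + 2 * k)]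
  have : (Nat.factorial (i + 2 * k) : ℝ) ≠ 0 := by positivity
  push_cast
  field_simp
  ring

lemma b_rr1 (k i : ℕ) : b (k : ℝ) (i + 1) * Real.sqrt (rr k (i + 1)) =
    Real.sqrt (rr k i) * ((i + 1) / (2 * ((k : ℝ) + i) + 1)) := by
  have h2 : Real.sqrt (((i + 1) / (2 * ((k : ℝ) + i) + 1)) ^ 2) =
    ((i + 1) / (2 * ((k : ℝ) + i) + 1)) := Real.sqrt_sq (by positivity)
  rw [← h2, ← Real.sqrt_mul (rr_pos k i).le, b]
  rw [← Real.sqrt_mul']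
  swap
  · exact (rr_pos k _).le
  congr 1
  have h := rr_succ k i
  have e : rr k i = rr k (i + 1) * ((2 * ((k : ℝ) + i) + 1) * (i + 1 + 2 * k)) /
     ((2 * ((k : ℝ) + i) + 3) * (i + 1)) := by
    rw [eq_div_iff (by positivity)]; exact h.symm
  rw [e]
  have e1 : (2 * ((i : ℝ) + 1) + 2 * k + 1) = 2 * ((k : ℝ) + i) + 3 := by ring
  have e2 : (2 * ((i : ℝ) + 1) + 2 * k - 1) = 2 * ((k : ℝ) + i) + 1 := by ring
  rw [e1, e2]
  field_simp

lemma b_pos_s15 (k i : ℕ) : 0 < b (k : ℝ) i := by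
  cases i with
  | zero =>
    unfold b
    have h1 : 0 < Real.Gamma ((k : ℝ) + 1) := Real.Gamma_pos_of_pos (by positivity)
    have h2 : 0 < Real.Gamma ((k : ℝ) + 3 / 2) := Real.Gamma_pos_of_pos (by positivity)
    have := Real.pi_pos
    positivity
  | succ i =>
    rw [b]
    have e2 : (2 * ((i : ℝ) + 1) + 2 * k - 1) = 2 * ((k : ℝ) + i) + 1 := by ring
    rw [e2]
    positivity

lemma b_rr2 (k i : ℕ) : b (k : ℝ) (i + 1) * Real.sqrt (rr k i) =
    Real.sqrt (rr k (i + 1)) * ((i + 1 + 2 * k) / (2 * ((k : ℝ) + i) + 3)) := by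
  have h := b_rr1 k i
  have hb := b_pos_s15 k (i + 1)
  have hsq : b (k : ℝ) (i + 1) ^ 2 = ((i : ℝ) + 1) * (i + 1 + 2 * k) /
      ((2 * ((k : ℝ) + i) + 3) * (2 * ((k : ℝ) + i) + 1)) := by
    have e1 : (2 * ((i : ℝ) + 1) + 2 * k + 1) = 2 * ((k : ℝ) + i) + 3 := by ring
    have e2 : (2 * ((i : ℝ) + 1) + 2 * k - 1) = 2 * ((k : ℝ) + i) + 1 := by ring
    rw [b, e1, e2, Real.sq_sqrt (by positivity)]
  have hs : Real.sqrt (rr k i) = b (k : ℝ) (i + 1) * Real.sqrt (rr k (i + 1)) *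
      ((2 * ((k : ℝ) + i) + 1) / (i + 1)) := by
    rw [h]; field_simp
  rw [hs]
  calc _ = b (k : ℝ) (i + 1) ^ 2 * Real.sqrt (rr k (i + 1)) * ((2 * ((k : ℝ) + i) + 1) / (i + 1)) := by ring
    _ = _ := by rw [hsq]; field_simp

open Polynomial in
lemma b_zero (k : ℕ) (x : ℝ) : 1 / b (k : ℝ) 0 = Real.sqrt (rr k 0) * (dleg k k).eval x := by
  induction k with
  | zero =>
    have hG : Real.Gamma (3 / 2) = Real.sqrt Real.pi / 2 := by
      have : (3 / 2 : ℝ) = 1 / 2 + 1 := by norm_num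
      rw [this, Real.Gamma_add_one (by norm_num), Real.Gamma_one_half_eq]; ring
    have hp : Real.sqrt Real.pi ≠ 0 := by have := Real.pi_pos; positivity
    simp [b, rr, dleg, leg, hG]
    field_simp
  | succ k ih =>
    have h1 : 0 < Real.Gamma ((k : ℝ) + 1) := Real.Gamma_pos_of_pos (by positivity)
    have h2 : 0 < Real.Gamma ((k : ℝ) + 3 / 2) := Real.Gamma_pos_of_pos (by positivity)
    have hb : b ((k + 1 : ℕ) : ℝ) 0 = b (k : ℝ) 0 * Real.sqrt (((k : ℝ) + 1) / (k + 3 / 2)) := by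
      unfold b
      rw [← Real.sqrt_mul (by positivity)]
      congr 1
      push_cast
      have e : (k : ℝ) + 1 + 3 / 2 = (k + 3 / 2) + 1 := by ring
      rw [e, Real.Gamma_add_one (s := (k : ℝ) + 1) (by positivity),
        Real.Gamma_add_one (s := (k : ℝ) + 3 / 2) (by positivity)]
      field_simp
    have hr : Real.sqrt (rr (k + 1) 0) * (2 * k + 1) * Real.sqrt (((k : ℝ) + 1) / (k + 3 / 2)) =
        Real.sqrt (rr k 0) := by
      have h3 : Real.sqrt ((2 * (k : ℝ) + 1) ^ 2) = 2 * k + 1 := Real.sqrt_sq (by positivity)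
      rw [← h3, ← Real.sqrt_mul (rr_pos _ _).le, ← Real.sqrt_mul (mul_nonneg (rr_pos _ _).le (by positivity))]
      congr 1
      unfold rr
      have e : 0 + 2 * (k + 1) = (0 + 2 * k) + 1 + 1 := by omega
      rw [e, Nat.factorial_succ, Nat.factorial_succ]
      have : (Nat.factorial (0 + 2 * k) : ℝ) ≠ 0 := by positivity
      push_cast
      field_simp
      ring
    have hs : 0 < Real.sqrt (((k : ℝ) + 1) / (k + 3 / 2)) := by positivity
    rw [hb, one_div, mul_inv, ← one_div, ih, dleg_diag, ← hr]
    simp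
    field_simp

open Polynomial in
lemma p_eq (k i : ℕ) (x : ℝ) : p (k : ℝ) i x = Real.sqrt (rr k i) * (dleg k (k + i)).eval x := by
  unfold p
  induction i using Nat.strong_induction_on with
  | _ i ih =>
    match i with
    | 0 => rw [pA]; exact b_zero k x
    | 1 =>
      rw [pA, div_eq_iff (b_pos_s15 k _).ne', b_zero k x, dleg_one]
      have h := b_rr1 k 0
      simp at h ⊢
      have h0 : (2 * (k : ℝ) + 1) ≠ 0 := by positivity
      field_simp at h
      linear_combination (-x * eval x (dleg k k)) * h
    | i + 2 =>
      rw [pA, div_eq_iff (b_pos_s15 k _).ne', ih (i + 1) (by omega), ih i (by omega)]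
      have hr := congrArg (eval x) (dleg_rec k i)
      simp only [eval_mul, eval_add, eval_sub, eval_natCast, eval_ofNat, eval_X, eval_one] at hr
      have h1 := b_rr1 k (i + 1)
      have h2 := b_rr2 k i
      have e : 0 + i + 1 = i + 1 := by omega
      have e' : 0 + i + 2 = i + 1 + 1 := by omega
      rw [e, e']
      push_cast at h1
      have h0 : (2 * ((k : ℝ) + i) + 3) ≠ 0 := by positivity
      have e3 : (2 * ((k : ℝ) + (i + 1)) + 1) = 2 * ((k : ℝ) + i) + 3 := by ring
      rw [e3] at h1
      have e4 : k + (i + 1) = k + i + 1 := by omega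
      have e5 : k + (i + 2) = k + i + 2 := by omega
      rw [e4, e5]
      have e6 : i + 2 = i + 1 + 1 := by omega
      rw [e6]
      apply mul_left_cancel₀ h0
      field_simp at h1 h2
      linear_combination (-eval x (dleg k (k+i))) * h2 - (eval x (dleg k (k+i+2))) * h1 - Real.sqrt (rr k (i+1)) * hr

/-- The addition theorem. -/
lemma unsold (l : ℕ) (θ : ℝ) : ∑ k ∈ Finset.Icc (-(l : ℤ)) (l : ℤ),
    (Real.sin θ ^ k.natAbs * p (k.natAbs : ℝ) (l - k.natAbs) (Real.cos θ)) ^ 2 = 2 * l + 1 := by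
  have key : ∀ k ≤ l, (Real.sin θ ^ k * p (k : ℝ) (l - k) (Real.cos θ)) ^ 2 =
      (2 * l + 1) * (acoef l k * (1 - Real.cos θ ^ 2) ^ k * (dleg k l).eval (Real.cos θ) ^ 2) := by
    intro k hk
    rw [p_eq, Nat.add_sub_cancel' hk, mul_pow, mul_pow, Real.sq_sqrt (rr_pos _ _).le,
      show 1 - Real.cos θ ^ 2 = Real.sin θ ^ 2 by rw [Real.sin_sq]]
    have : rr k (l - k) = (2 * l + 1) * acoef l k := by
      unfold rr acoef
      have e : l - k + 2 * k = l + k := by omega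
      rw [e, Nat.cast_sub hk]; ring
    rw [this]; ring
  rw [Finset.sum_Icc_of_even_eq_range (f := fun k : ℤ => (Real.sin θ ^ k.natAbs * p (k.natAbs : ℝ) (l - k.natAbs) (Real.cos θ)) ^ 2) (by intro k; simp)]
  have h := Fpoly_eval l (Real.cos θ)
  have h0 : acoef l 0 = 1 := by
    unfold acoef; simp [div_self (Nat.cast_ne_zero.mpr (Nat.factorial_ne_zero l) : (Nat.factorial l : ℝ) ≠ 0)]
  simp only [Int.natAbs_natCast, Int.natAbs_zero]
  rw [Finset.sum_congr rfl (fun k hk => key k (by simp at hk; omega)), key 0 (by omega),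
    Finset.sum_range_succ']
  simp [Fpoly, Polynomial.eval_finsetSum] at h
  rw [← Finset.mul_sum]
  simp [h0, dleg]
  simp [dleg] at h
  linear_combination (2 * (l : ℝ) + 1) * h

lemma p_cont (k i : ℕ) : Continuous (p (k : ℝ) i) := by
  have : p (k : ℝ) i = fun x => Real.sqrt (rr k i) * (dleg k (k + i)).eval x :=
    funext (p_eq k i)
  rw [this]
  fun_prop

lemma integrand_eq (j l : ℕ) (k : ℤ) (θ φ : ℝ) :
    Mpow j (Y l k) θ φ * (starRingEnd ℂ) (Y l k θ φ) * ((Real.sin θ : ℝ) : ℂ) =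
    ((Real.cos θ ^ j * (Real.sin θ ^ k.natAbs *
      p (k.natAbs : ℝ) (l - k.natAbs) (Real.cos θ)) ^ 2 * Real.sin θ : ℝ) : ℂ) := by
  have h : Complex.exp (Complex.I * (k : ℂ) * (φ : ℂ)) *
      (starRingEnd ℂ) (Complex.exp (Complex.I * (k : ℂ) * (φ : ℂ))) = 1 := by
    rw [← Complex.exp_conj, ← Complex.exp_add]
    simp
  unfold Mpow Y
  simp only [map_mul, Complex.conj_ofReal]
  push_cast
  linear_combination ((Complex.cos θ) ^ j * ((Complex.sin θ) ^ k.natAbs *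
      (p (k.natAbs : ℝ) (l - k.natAbs) (Real.cos θ) : ℂ)) ^ 2 * Complex.sin θ) * h

lemma int_theta (j : ℕ) : ∫ θ in Set.Icc (0 : ℝ) Real.pi, Real.cos θ ^ j * Real.sin θ =
    ∫ t in (-1 : ℝ)..1, t ^ j := by
  rw [integral_Icc_eq_integral_Ioc, ← intervalIntegral.integral_of_le Real.pi_pos.le]
  have h := intervalIntegral.integral_comp_mul_deriv (a := 0) (b := Real.pi) (f := Real.cos)
    (f' := fun x => -Real.sin x) (g := fun t : ℝ => t ^ j)
    (fun x _ => Real.hasDerivAt_cos x) (by fun_prop) (by fun_prop)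
  simp only [Function.comp, Real.cos_zero, Real.cos_pi] at h
  rw [intervalIntegral.integral_symm (1 : ℝ) (-1), ← h, ← intervalIntegral.integral_neg]
  simp

lemma sum_inner (j l : ℕ) : ∑ k ∈ Finset.Icc (-(l : ℤ)) (l : ℤ),
    inner2 (Mpow j (Y l k)) (Y l k) =
      (((2 * (l : ℝ) + 1) / 2 * ∫ t in (-1 : ℝ)..1, t ^ j : ℝ) : ℂ) := by
  have hcomp : IsCompact region := isCompact_Icc.prod isCompact_Icc
  unfold inner2
  simp only [integrand_eq]
  rw [← Finset.mul_sum]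
  simp only [integral_complex_ofReal]
  rw [← Complex.ofReal_sum, ← integral_finset_sum]
  swap
  · intro k _
    apply ContinuousOn.integrableOn_compact hcomp
    have := p_cont k.natAbs (l - k.natAbs)
    fun_prop
  have h : ∀ q : ℝ × ℝ, ∑ k ∈ Finset.Icc (-(l : ℤ)) (l : ℤ), (Real.cos q.1 ^ j *
      (Real.sin q.1 ^ k.natAbs * p (k.natAbs : ℝ) (l - k.natAbs) (Real.cos q.1)) ^ 2 *
        Real.sin q.1) = (Real.cos q.1 ^ j * Real.sin q.1) * (2 * l + 1) := by
    intro q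
    rw [← unsold l q.1, Finset.mul_sum]
    exact Finset.sum_congr rfl fun k _ => by ring
  simp only [h]
  have h2 := setIntegral_prod_mul (μ := volume) (ν := volume)
    (fun θ : ℝ => Real.cos θ ^ j * Real.sin θ) (fun _ : ℝ => (2 * (l : ℝ) + 1))
    (Set.Icc 0 Real.pi) (Set.Icc 0 (2 * Real.pi))
  rw [int_theta] at h2
  rw [region, Measure.volume_eq_prod, h2]
  have hpi := Real.pi_pos
  have hpi' : (Real.pi : ℂ) ≠ 0 := by exact_mod_cast hpi.ne'
  rw [setIntegral_const, Real.volume_real_Icc_of_le (by positivity)]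
  push_cast [smul_eq_mul]
  field_simp
  ring

lemma sum_odd (n m : ℕ) (hmn : m ≤ n) :
    ∑ l ∈ Finset.Icc m n, (2 * (l : ℝ) + 1) = (((n + 1) ^ 2 - m ^ 2 : ℕ) : ℝ) := by
  rw [Nat.cast_sub (Nat.pow_le_pow_left (by omega) 2)]
  induction n, hmn using Nat.le_induction with
  | base => simp; ring
  | succ n hn ih =>
    rw [← Finset.insert_Icc_right_eq_Icc_add_one (by omega), Finset.sum_insert (by simp), ih]
    push_cast; ring

/-- `Σ_{l=m}^n Σ_{k=−l}^l ⟨M^j Y_l^k, Y_l^k⟩ = (N_n^m/2) ∫_{−1}^1 x^j dx`,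
i.e. the trace of `P_n^m M^j P_n^m` restricted to `Π_n^m` equals
`(((n+1)² − m²)/2) ∫_{−1}^1 x^j dx`. -/
theorem stmt15 (n m j : ℕ) (hmn : m ≤ n) :
    ∑ l ∈ Finset.Icc m n, ∑ k ∈ Finset.Icc (-(l : ℤ)) (l : ℤ),
        inner2 (Mpow j (Y l k)) (Y l k) =
      (((((n + 1) ^ 2 - m ^ 2 : ℕ) : ℝ) / 2 * ∫ t in (-1 : ℝ)..1, t ^ j : ℝ) : ℂ) := by
  simp only [sum_inner]
  rw [← Complex.ofReal_sum, ← Finset.sum_mul, ← Finset.sum_div, sum_odd n m hmn]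
end SFT
end
end
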